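/- Let T ⊂ SL(2,ℂ) be the binary tetrahedral group generated by diag(i,−i), [[0,i],[i,0]], and (1/2)[[1+i, −1+i],[1+i, 1−i]], and set F₁ = x⁴ + 2√−3·x²y² + y⁴, F₂ = x⁴ − 2√−3·x²y² + y⁴, F₃ = xy(x⁴−y⁴). A nonzero binary form f ∈ ℂ[x,y] is semi-invariant under every element of T if and only if f is a nonzero scalar multiple of F₁^α F₂^β F₃^γ ∏_{i=1}^N (λ_i F₁³ + μ_i F₂³) for some nonnegative integers α, β, γ, N and pairs (λ_i, μ_i) ∈ ℂ² \ {(0,0)}. -/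

import Mathlib

open MvPolynomial Matrix

noncomputable section

/-- Polynomials in two variables `x = X 0`, `y = X 1` over `ℂ`. -/
abbrev BPoly : Type := MvPolynomial (Fin 2) ℂ

/-- The variable `x`. -/
def Px : BPoly := X 0

/-- The variable `y`. -/
def Py : BPoly := X 1

/-- Substitution action of a 2×2 matrix on polynomials in two variables:
for `A = [[p,q],[r,s]]`, `(f·A)(x,y) = f(px+qy, rx+sy)`. -/
def matAct (A : Matrix (Fin 2) (Fin 2) ℂ) (f : BPoly) : BPoly :=
  bind₁ (fun i => C (A i 0) * Px + C (A i 1) * Py) f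

/-- `f` is semi-invariant under `A`: `f·A = c·f` for some nonzero scalar `c`. -/
def SemiInv (A : Matrix (Fin 2) (Fin 2) ℂ) (f : BPoly) : Prop :=
  ∃ c : ℂ, c ≠ 0 ∧ matAct A f = C c * f

/-- The stabilizer of `f` inside `SL(2,ℂ)`: all matrices under which `f` is
semi-invariant. -/
def Stab (f : BPoly) : Set (SpecialLinearGroup (Fin 2) ℂ) :=
  {A | SemiInv (A : Matrix (Fin 2) (Fin 2) ℂ) f}

/-- `f` is a (nonzero) binary form: nonzero and homogeneous of some degree. -/
def IsBinaryForm (f : BPoly) : Prop :=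
  f ≠ 0 ∧ ∃ d : ℕ, f.IsHomogeneous d

/-- `f` is `SL(2,ℂ)`-equivalent to `g` up to a nonzero scalar:
`c·(f·A) = g` for some `A ∈ SL(2,ℂ)` and `c ≠ 0`. -/
def EquivForm (f g : BPoly) : Prop :=
  ∃ A : SpecialLinearGroup (Fin 2) ℂ, ∃ c : ℂ, c ≠ 0 ∧
    C c * matAct (A : Matrix (Fin 2) (Fin 2) ℂ) f = g


lemma matAct_add (A : Matrix (Fin 2) (Fin 2) ℂ) (f g : BPoly) :
    matAct A (f + g) = matAct A f + matAct A g := map_add _ _ _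

lemma matAct_sub (A : Matrix (Fin 2) (Fin 2) ℂ) (f g : BPoly) :
    matAct A (f - g) = matAct A f - matAct A g := map_sub _ _ _

lemma matAct_mul (A : Matrix (Fin 2) (Fin 2) ℂ) (f g : BPoly) :
    matAct A (f * g) = matAct A f * matAct A g := map_mul _ _ _

lemma matAct_pow (A : Matrix (Fin 2) (Fin 2) ℂ) (f : BPoly) (n : ℕ) :
    matAct A (f ^ n) = matAct A f ^ n := map_pow _ _ _

lemma matAct_C (A : Matrix (Fin 2) (Fin 2) ℂ) (c : ℂ) :
    matAct A (C c) = C c := bind₁_C_right _ _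

lemma matAct_Px (A : Matrix (Fin 2) (Fin 2) ℂ) :
    matAct A Px = C (A 0 0) * Px + C (A 0 1) * Py := bind₁_X_right _ _

lemma matAct_Py (A : Matrix (Fin 2) (Fin 2) ℂ) :
    matAct A Py = C (A 1 0) * Px + C (A 1 1) * Py := bind₁_X_right _ _

lemma matAct_one (f : BPoly) : matAct 1 f = f := by
  have h : (fun i : Fin 2 => C ((1 : Matrix (Fin 2) (Fin 2) ℂ) i 0) * Px +
      C ((1 : Matrix (Fin 2) (Fin 2) ℂ) i 1) * Py) = X := by
    refine funext (Fin.forall_fin_two.2 ⟨?_, ?_⟩) <;> simp [Px, Py]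
  rw [matAct, h, bind₁_X_left, AlgHom.id_apply]

lemma matAct_matAct (A B : Matrix (Fin 2) (Fin 2) ℂ) (f : BPoly) :
    matAct B (matAct A f) = matAct (A * B) f := by
  unfold matAct
  rw [bind₁_bind₁]
  congr 2
  funext i
  simp only [Px, Py, map_add, map_mul, bind₁_C_right, bind₁_X_right, Matrix.mul_apply,
    Fin.sum_univ_two]
  ring

/-- Substitution by a matrix as a linear map. -/
def actLin (A : Matrix (Fin 2) (Fin 2) ℂ) : BPoly →ₗ[ℂ] BPoly :=
  (bind₁ (fun i => C (A i 0) * Px + C (A i 1) * Py)).toLinearMap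

lemma actLin_apply (A : Matrix (Fin 2) (Fin 2) ℂ) (f : BPoly) : actLin A f = matAct A f := rfl

lemma SemiInv.mul {A : Matrix (Fin 2) (Fin 2) ℂ} {f g : BPoly}
    (hf : SemiInv A f) (hg : SemiInv A g) : SemiInv A (f * g) := by
  obtain ⟨a, ha, hf⟩ := hf
  obtain ⟨b, hb, hg⟩ := hg
  refine ⟨a * b, mul_ne_zero ha hb, ?_⟩
  rw [matAct_mul, hf, hg, C_mul]
  ring

lemma SemiInv.const (A : Matrix (Fin 2) (Fin 2) ℂ) (c : ℂ) : SemiInv A (C c) :=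
  ⟨1, one_ne_zero, by rw [matAct_C, C_1, one_mul]⟩

lemma SemiInv.pow {A : Matrix (Fin 2) (Fin 2) ℂ} {f : BPoly}
    (hf : SemiInv A f) (n : ℕ) : SemiInv A (f ^ n) := by
  induction n with
  | zero => simpa using SemiInv.const A 1
  | succ n ih => rw [pow_succ]; exact ih.mul hf

lemma SemiInv.prod {ι : Type*} {A : Matrix (Fin 2) (Fin 2) ℂ} (s : Finset ι) (f : ι → BPoly)
    (hf : ∀ i ∈ s, SemiInv A (f i)) : SemiInv A (∏ i ∈ s, f i) := by
  classical
  induction s using Finset.induction_on with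
  | empty => simpa using SemiInv.const A 1
  | insert a s ha ih =>
    rw [Finset.prod_insert ha]
    exact (hf a (by simp)).mul (ih fun i hi => hf i (by simp [hi]))

/-- A form which is semi-invariant under generators is semi-invariant under the generated group. -/
lemma SemiInv.of_mem_closure {S : Set (SpecialLinearGroup (Fin 2) ℂ)} {f : BPoly}
    (hS : ∀ A ∈ S, SemiInv (A : Matrix (Fin 2) (Fin 2) ℂ) f)
    {A : SpecialLinearGroup (Fin 2) ℂ} (hA : A ∈ Subgroup.closure S) :
    SemiInv (A : Matrix (Fin 2) (Fin 2) ℂ) f := by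
  induction hA using Subgroup.closure_induction with
  | mem A hA => exact hS A hA
  | one => exact ⟨1, one_ne_zero, by simp [matAct_one]⟩
  | mul A B _ _ hA hB =>
    obtain ⟨a, ha, hA⟩ := hA
    obtain ⟨b, hb, hB⟩ := hB
    refine ⟨a * b, mul_ne_zero ha hb, ?_⟩
    change matAct (A.1 * B.1) f = _
    rw [← matAct_matAct, hA, matAct_mul, matAct_C, hB, C_mul, mul_assoc]
  | inv A _ hA =>
    obtain ⟨a, ha, hA⟩ := hA
    refine ⟨a⁻¹, inv_ne_zero ha, ?_⟩
    have h : matAct ((A⁻¹ : SpecialLinearGroup (Fin 2) ℂ) : Matrix (Fin 2) (Fin 2) ℂ)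
        (matAct (A : Matrix (Fin 2) (Fin 2) ℂ) f) = f := by
      rw [matAct_matAct]
      change matAct (A * A⁻¹).1 f = f
      rw [mul_inv_cancel]
      exact matAct_one f
    rw [hA, matAct_mul, matAct_C] at h
    conv_rhs => rw [← h]
    rw [← mul_assoc, ← C_mul, inv_mul_cancel₀ ha, C_1, one_mul]

/-- The first generator of the binary tetrahedral group. -/
def genA : Matrix (Fin 2) (Fin 2) ℂ := !![Complex.I, 0; 0, -Complex.I]

/-- The second generator of the binary tetrahedral group. -/
def genB : Matrix (Fin 2) (Fin 2) ℂ := !![0, Complex.I; Complex.I, 0]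

/-- The third generator of the binary tetrahedral group. -/
def genC : Matrix (Fin 2) (Fin 2) ℂ :=
  !![(1 + Complex.I) / 2, (-1 + Complex.I) / 2; (1 + Complex.I) / 2, (1 - Complex.I) / 2]

/-- The quartic `x⁴ + 2 s x² y² + y⁴`; for `s = ±√-3` these are the quartic ground forms. -/
def quartic (s : ℂ) : BPoly := Px ^ 4 + C (2 * s) * Px ^ 2 * Py ^ 2 + Py ^ 4

/-- The sextic ground form `xy(x⁴ - y⁴)`. -/
def sextic : BPoly := Px * Py * (Px ^ 4 - Py ^ 4)

lemma quartic_neg (s : ℂ) :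
    quartic (-s) = Px ^ 4 - C (2 * s) * Px ^ 2 * Py ^ 2 + Py ^ 4 := by
  simp only [quartic, mul_neg, C_neg]
  ring

lemma C_I_sq : (C Complex.I : BPoly) ^ 2 = -1 := by
  rw [← C_pow, Complex.I_sq, C_neg, C_1]

lemma genA_Px : matAct genA Px = C Complex.I * Px := by
  simp [matAct_Px, genA]

lemma genA_Py : matAct genA Py = -C Complex.I * Py := by
  simp [matAct_Py, genA]

lemma genB_Px : matAct genB Px = C Complex.I * Py := by
  simp [matAct_Px, genB]

lemma genB_Py : matAct genB Py = C Complex.I * Px := by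
  simp [matAct_Py, genB]

lemma genC_Px : matAct genC Px = C ((1 + Complex.I) / 2) * (Px + C Complex.I * Py) := by
  have h : (-1 + Complex.I) / 2 = (1 + Complex.I) / 2 * Complex.I := by
    linear_combination (-1 / 2) * Complex.I_sq
  simp only [matAct_Px, genC, Matrix.of_apply, Matrix.cons_val', Matrix.cons_val_zero,
    Matrix.cons_val_one, Matrix.cons_val_fin_one, h, C_mul]
  ring

lemma genC_Py : matAct genC Py = C ((1 + Complex.I) / 2) * (Px - C Complex.I * Py) := by
  have h : (1 - Complex.I) / 2 = -((1 + Complex.I) / 2 * Complex.I) := by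
    linear_combination (1 / 2) * Complex.I_sq
  simp only [matAct_Py, genC, Matrix.of_apply, Matrix.cons_val', Matrix.cons_val_zero,
    Matrix.cons_val_one, Matrix.cons_val_fin_one, h, C_mul, C_neg]
  ring

lemma genA_quartic (s : ℂ) : matAct genA (quartic s) = quartic s := by
  have hi := C_I_sq
  simp only [quartic, matAct_add, matAct_mul, matAct_pow, matAct_C, genA_Px, genA_Py]
  grind

lemma genB_quartic (s : ℂ) : matAct genB (quartic s) = quartic s := by
  have hi := C_I_sq
  simp only [quartic, matAct_add, matAct_mul, matAct_pow, matAct_C, genB_Px, genB_Py]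
  grind

lemma C_half_sq : (C ((1 + Complex.I) / 2) : BPoly) ^ 2 = C (1 / 2) * C Complex.I := by
  rw [← C_pow, ← C_mul]
  congr 1
  linear_combination (1 / 4) * Complex.I_sq

lemma C_half : 2 * (C (1 / 2) : BPoly) = 1 := by
  rw [show (2 : BPoly) = C 2 from (map_ofNat C 2).symm, ← C_mul]
  norm_num

lemma genC_quartic {s : ℂ} (hs : s ^ 2 = -3) :
    matAct genC (quartic s) = C (-(1 + s) / 2) * quartic s := by
  have hi := C_I_sq
  have hp := C_half_sq
  have hh := C_half
  have hs' : (C s : BPoly) ^ 2 = -3 := by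
    rw [← C_pow, hs, C_neg, show (3 : BPoly) = C 3 from (map_ofNat C 3).symm]
  have h2 : (C (2 * s) : BPoly) = 2 * C s := by rw [C_mul, map_ofNat]
  have hw : (C (-(1 + s) / 2) : BPoly) = -C (1 / 2) * (1 + C s) := by
    rw [← C_1, ← C_add, ← C_neg, ← C_mul]
    congr 1
    ring
  simp only [quartic, matAct_add, matAct_mul, matAct_pow, matAct_C, genC_Px, genC_Py, hw]
  simp only [h2]
  generalize (C ((1 + Complex.I) / 2) : BPoly) = p at *
  generalize (C (1 / 2) : BPoly) = h at *
  generalize (C Complex.I : BPoly) = i at *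
  generalize (C s : BPoly) = t at *
  have hp4 : p ^ 4 = -h ^ 2 := by linear_combination (p ^ 2 + h * i) * hp + h ^ 2 * hi
  have e1 : (Px + i * Py) ^ 4 + (Px - i * Py) ^ 4 =
      2 * (Px ^ 4 - 6 * Px ^ 2 * Py ^ 2 + Py ^ 4) := by
    linear_combination (12 * Px ^ 2 * Py ^ 2 + 2 * Py ^ 4 * (i ^ 2 - 1)) * hi
  have e2 : (Px + i * Py) * (Px - i * Py) = Px ^ 2 + Py ^ 2 := by
    linear_combination (-Py ^ 2) * hi
  have e3 : (p * (Px + i * Py)) ^ 4 + 2 * t * (p * (Px + i * Py)) ^ 2 * (p * (Px - i * Py)) ^ 2 +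
      (p * (Px - i * Py)) ^ 4 = p ^ 4 * (((Px + i * Py) ^ 4 + (Px - i * Py) ^ 4) +
        2 * t * ((Px + i * Py) * (Px - i * Py)) ^ 2) := by ring
  rw [e3, e1, e2, hp4]
  grind

lemma genA_sextic : matAct genA sextic = sextic := by
  have hi := C_I_sq
  simp only [sextic, matAct_sub, matAct_mul, matAct_pow, genA_Px, genA_Py]
  grind

lemma genB_sextic : matAct genB sextic = sextic := by
  have hi := C_I_sq
  simp only [sextic, matAct_sub, matAct_mul, matAct_pow, genB_Px, genB_Py]
  grind

lemma genC_sextic : matAct genC sextic = sextic := by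
  have hi := C_I_sq
  have hp := C_half_sq
  have hh := C_half
  simp only [sextic, matAct_sub, matAct_mul, matAct_pow, genC_Px, genC_Py]
  generalize (C ((1 + Complex.I) / 2) : BPoly) = p at *
  generalize (C (1 / 2) : BPoly) = h at *
  generalize (C Complex.I : BPoly) = i at *
  have hp6 : p ^ 6 = -h ^ 3 * i := by
    linear_combination (p ^ 4 + h * i * p ^ 2 + h ^ 2 * i ^ 2) * hp + h ^ 3 * i * hi
  have e1 : (Px + i * Py) ^ 4 - (Px - i * Py) ^ 4 =
      8 * i * (Px * Py * (Px ^ 2 - Py ^ 2)) := by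
    linear_combination (8 * i * Px * Py ^ 3) * hi
  have e2 : (Px + i * Py) * (Px - i * Py) = Px ^ 2 + Py ^ 2 := by
    linear_combination (-Py ^ 2) * hi
  have e3 : p * (Px + i * Py) * (p * (Px - i * Py)) *
      ((p * (Px + i * Py)) ^ 4 - (p * (Px - i * Py)) ^ 4) = p ^ 6 *
        (((Px + i * Py) * (Px - i * Py)) * ((Px + i * Py) ^ 4 - (Px - i * Py) ^ 4)) := by ring
  have hh3 : 8 * h ^ 3 = 1 := by linear_combination (4 * h ^ 2 + 2 * h + 1) * hh
  rw [e3, e1, e2, hp6]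
  linear_combination (-8 * h ^ 3 * (Px ^ 2 + Py ^ 2) * (Px * Py * (Px ^ 2 - Py ^ 2))) * hi +
    ((Px ^ 2 + Py ^ 2) * (Px * Py * (Px ^ 2 - Py ^ 2))) * hh3

lemma mem_span_monomials_of_isHomogeneous {f : BPoly} {d : ℕ} (hf : f.IsHomogeneous d) :
    f ∈ Submodule.span ℂ {g : BPoly | ∃ m n, m + n = d ∧ g = Px ^ m * Py ^ n} := by
  rw [f.as_sum]
  refine Submodule.sum_mem _ fun v hv => ?_
  have hd := hf.degree_eq_sum_deg_support hv
  rw [Finset.sum_subset (Finset.subset_univ _) (by simp), Fin.sum_univ_two] at hd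
  rw [MvPolynomial.monomial_eq, ← MvPolynomial.smul_eq_C_mul]
  refine Submodule.smul_mem _ _ (Submodule.subset_span ⟨v 0, v 1, hd.symm, ?_⟩)
  rw [Finsupp.prod_fintype _ _ (by simp), Fin.prod_univ_two]
  rfl

lemma eq_of_C_mul_eq {f : BPoly} (hf : f ≠ 0) {a b : ℂ} (h : C a * f = C b * f) : a = b :=
  C_injective _ _ (mul_right_cancel₀ hf h)

/-- Characters of the binary tetrahedral group are trivial on the quaternion subgroup and have
order dividing three. -/
lemma eigenvalues_of_semiInv {f : BPoly} (hf : f ≠ 0) {a b c : ℂ} (hb : b ≠ 0) (hc : c ≠ 0)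
    (hA : matAct genA f = C a * f) (hB : matAct genB f = C b * f)
    (hC : matAct genC f = C c * f) : a = 1 ∧ b = 1 ∧ c ^ 3 = 1 := by
  have hI := Complex.I_sq
  have r1 : genC * genA = genB * genC := by
    ext i j; fin_cases i <;> fin_cases j <;> simp [genA, genB, genC] <;> grind
  have r2 : genC * genB = genA * genB * genC := by
    ext i j; fin_cases i <;> fin_cases j <;> simp [genA, genB, genC] <;> grind
  have r3 : genC * genC * genC = genA * genA := by
    ext i j; fin_cases i <;> fin_cases j <;> simp [genA, genC] <;> grind
  have e1 : c * a = b * c := by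
    have h := congrArg (fun M => matAct M f) r1
    simp only [← matAct_matAct, hA, hB, hC, matAct_mul, matAct_C, ← mul_assoc, ← C_mul] at h
    exact eq_of_C_mul_eq hf h
  have e2 : c * b = a * b * c := by
    have h := congrArg (fun M => matAct M f) r2
    simp only [← matAct_matAct, hA, hB, hC, matAct_mul, matAct_C, ← mul_assoc, ← C_mul] at h
    exact eq_of_C_mul_eq hf h
  have e3 : c * c * c = a * a := by
    have h := congrArg (fun M => matAct M f) r3
    simp only [← matAct_matAct, hA, hC, matAct_mul, matAct_C, ← mul_assoc, ← C_mul] at h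
    exact eq_of_C_mul_eq hf h
  have ha1 : a = 1 := by
    apply mul_right_cancel₀ (mul_ne_zero hb hc)
    linear_combination -e2
  have hb1 : b = 1 := by
    apply mul_right_cancel₀ hc
    linear_combination -e1 + c * ha1
  refine ⟨ha1, hb1, ?_⟩
  rw [ha1] at e3
  linear_combination e3

section PowerSums

variable {L : Submodule ℂ BPoly} {u v : BPoly}

lemma add_pow_mem_pow (h1 : u + v ∈ L) (h2 : u * v ∈ L ^ 2) (k : ℕ) : u ^ k + v ^ k ∈ L ^ k := by
  induction k using Nat.twoStepInduction with
  | zero =>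
    rw [pow_zero, pow_zero, pow_zero]
    exact Submodule.add_mem _ (Submodule.mem_one.2 ⟨1, map_one _⟩)
      (Submodule.mem_one.2 ⟨1, map_one _⟩)
  | one => simpa using h1
  | more k ih0 ih1 =>
    have m1 : (u + v) * (u ^ (k + 1) + v ^ (k + 1)) ∈ L ^ (k + 2) := by
      rw [show k + 2 = 1 + (k + 1) by ring, pow_add L, pow_one]
      exact Submodule.mul_mem_mul h1 ih1
    have m2 : u * v * (u ^ k + v ^ k) ∈ L ^ (k + 2) := by
      rw [add_comm, pow_add L]
      exact Submodule.mul_mem_mul h2 ih0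
    convert Submodule.sub_mem _ m1 m2 using 1
    ring

lemma exists_sub_pow_eq_mul (h1 : u + v ∈ L) (h2 : u * v ∈ L ^ 2) (k : ℕ) :
    ∃ h ∈ L ^ k, u ^ (k + 1) - v ^ (k + 1) = (u - v) * h := by
  induction k using Nat.twoStepInduction with
  | zero => exact ⟨1, by rw [pow_zero]; exact Submodule.mem_one.2 ⟨1, map_one _⟩, by ring⟩
  | one => exact ⟨u + v, by simpa using h1, by ring⟩
  | more k ih0 ih1 =>
    obtain ⟨g0, hg0, e0⟩ := ih0
    obtain ⟨g1, hg1, e1⟩ := ih1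
    have m1 : (u + v) * g1 ∈ L ^ (k + 2) := by
      rw [show k + 2 = 1 + (k + 1) by ring, pow_add L, pow_one]
      exact Submodule.mul_mem_mul h1 hg1
    have m2 : u * v * g0 ∈ L ^ (k + 2) := by
      rw [add_comm, pow_add L]
      exact Submodule.mul_mem_mul h2 hg0
    refine ⟨_, Submodule.sub_mem _ m1 m2, ?_⟩
    linear_combination (u + v) * e1 - u * v * e0

end PowerSums

/-- The pencil spanned by the two quartic ground forms. -/
def pencil (s : ℂ) : Submodule ℂ BPoly := Submodule.span ℂ {quartic s, quartic (-s)}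

lemma pow_four_add_mem_pencil (s : ℂ) : Px ^ 4 + Py ^ 4 ∈ pencil s := by
  have h : Px ^ 4 + Py ^ 4 = (1 / 2 : ℂ) • (quartic s + quartic (-s)) := by
    rw [quartic_neg, quartic, smul_eq_C_mul]
    linear_combination (-(Px ^ 4 + Py ^ 4)) * C_half
  rw [h]
  exact Submodule.smul_mem _ _ (Submodule.add_mem _ (Submodule.subset_span (by simp))
    (Submodule.subset_span (by simp)))

lemma mul_sq_mem_pencil {s : ℂ} (hs : s ≠ 0) : (Px * Py) ^ 2 ∈ pencil s := by
  have h : (Px * Py) ^ 2 = (1 / (4 * s) : ℂ) • (quartic s - quartic (-s)) := by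
    have e : (C (1 / (4 * s)) : BPoly) * (2 * C (2 * s)) = 1 := by
      rw [show (2 : BPoly) = C 2 from (map_ofNat C 2).symm, ← C_mul, ← C_mul, ← C_1]
      congr 1
      field_simp
      norm_num
    rw [quartic_neg, quartic, smul_eq_C_mul]
    linear_combination (-(Px ^ 2 * Py ^ 2)) * e
  rw [h]
  exact Submodule.smul_mem _ _ (Submodule.sub_mem _ (Submodule.subset_span (by simp))
    (Submodule.subset_span (by simp)))

/-- A space of forms containing all degree `d` invariants of the quaternion group. -/
def quaternionSpan (s : ℂ) (d : ℕ) : Submodule ℂ BPoly :=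
  if d % 4 = 0 then pencil s ^ (d / 4)
  else (pencil s ^ ((d - 6) / 4)).map (LinearMap.mulLeft ℂ sextic)

lemma I_pow_eq_one_iff (k : ℕ) : Complex.I ^ k = 1 ↔ k % 4 = 0 := by
  rw [Complex.I_pow_eq_pow_mod]
  have : k % 4 < 4 := Nat.mod_lt _ (by norm_num)
  interval_cases k % 4 <;> norm_num [Complex.ext_iff, pow_succ]

lemma I_pow_two_mul (n : ℕ) : Complex.I ^ (2 * n) = (-1) ^ n := by
  rw [pow_mul, Complex.I_sq]

lemma symmetrized_mem_quaternionSpan {s : ℂ} (hs : s ≠ 0) (n j : ℕ) :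
    Px ^ (n + 4 * j) * Py ^ n + C (Complex.I ^ (2 * n + 4 * j)) * (Px ^ n * Py ^ (n + 4 * j)) ∈
      quaternionSpan s (2 * n + 4 * j) := by
  have h1 := pow_four_add_mem_pencil s
  have h2 : Px ^ 4 * Py ^ 4 ∈ pencil s ^ 2 := by
    convert Submodule.pow_mem_pow _ (mul_sq_mem_pencil hs) 2 using 1
    ring
  have hI : Complex.I ^ (2 * n + 4 * j) = (-1) ^ n := by
    rw [pow_add, I_pow_two_mul, (I_pow_eq_one_iff (4 * j)).2 (by omega), mul_one]
  rw [hI]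
  obtain ⟨l, rfl | rfl⟩ := Nat.even_or_odd' n
  · rw [quaternionSpan, if_pos (by omega), show (2 * (2 * l) + 4 * j) / 4 = l + j by omega, pow_add]
    convert Submodule.mul_mem_mul (Submodule.pow_mem_pow _ (mul_sq_mem_pencil hs) l)
      (add_pow_mem_pow h1 h2 j) using 1
    simp only [pow_mul, pow_add, mul_pow, neg_one_sq, one_pow, C_1]
    ring
  · rw [quaternionSpan, if_neg (by omega)]
    cases j with
    | zero => simp [pow_succ, pow_mul]
    | succ j =>
      obtain ⟨h, hh, e⟩ := exists_sub_pow_eq_mul h1 h2 j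
      refine ⟨((Px * Py) ^ 2) ^ l * h, ?_, ?_⟩
      · rw [show (2 * (2 * l + 1) + 4 * (j + 1) - 6) / 4 = l + j by omega, pow_add]
        exact Submodule.mul_mem_mul (Submodule.pow_mem_pow _ (mul_sq_mem_pencil hs) l) hh
      · have e' : (Px ^ 4) ^ (j + 1) = (Px ^ 4 - Py ^ 4) * h + (Py ^ 4) ^ (j + 1) := by
          rw [← e]; ring
        rw [pow_add Px _ (4 * (j + 1)), pow_add Py _ (4 * (j + 1)), pow_mul Px 4, pow_mul Py 4, e']
        simp only [LinearMap.mulLeft_apply, sextic, pow_succ (-1 : ℂ), pow_mul (-1 : ℂ) 2,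
          pow_zero, one_mul, neg_mul_neg, one_pow, C_neg, C_1]
        ring

lemma quaternionSpan_monomial {s : ℂ} (hs : s ≠ 0) {m n : ℕ} (h : (m + 3 * n) % 4 = 0) :
    Px ^ m * Py ^ n + matAct genB (Px ^ m * Py ^ n) ∈ quaternionSpan s (m + n) := by
  have hB : matAct genB (Px ^ m * Py ^ n) = C (Complex.I ^ (m + n)) * (Px ^ n * Py ^ m) := by
    rw [matAct_mul, matAct_pow, matAct_pow, genB_Px, genB_Py, pow_add, C_mul, C_pow, C_pow]
    ring
  rw [hB]
  obtain h' | h' := le_total n m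
  · obtain ⟨j, rfl⟩ : ∃ j, m = n + 4 * j := ⟨(m - n) / 4, by omega⟩
    have := symmetrized_mem_quaternionSpan hs n j
    rwa [show n + 4 * j + n = 2 * n + 4 * j by ring]
  · obtain ⟨j, rfl⟩ : ∃ j, n = m + 4 * j := ⟨(n - m) / 4, by omega⟩
    have := Submodule.smul_mem _ (Complex.I ^ (2 * m + 4 * j))
      (symmetrized_mem_quaternionSpan hs m j)
    rw [show m + (m + 4 * j) = 2 * m + 4 * j by ring]
    convert this using 1
    have e : (C (Complex.I ^ (2 * m + 4 * j)) : BPoly) * C (Complex.I ^ (2 * m + 4 * j)) = 1 := by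
      rw [← C_mul, ← pow_add, (I_pow_eq_one_iff _).2 (by omega), C_1]
    rw [smul_eq_C_mul]
    linear_combination (-(Px ^ m * Py ^ (m + 4 * j))) * e

/-- Eight times the averaging operator over the quaternion group modulo its center. -/
def quaternionSum : BPoly →ₗ[ℂ] BPoly :=
  (1 + actLin genB) ∘ₗ
    (1 + actLin genA + actLin genA ∘ₗ actLin genA + actLin genA ∘ₗ actLin genA ∘ₗ actLin genA)

lemma geom_sum_four {e : ℂ} (he : e ^ 4 = 1) (h1 : e ≠ 1) : 1 + e + e * e + e * (e * e) = 0 := by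
  apply mul_left_cancel₀ (sub_ne_zero.2 h1)
  linear_combination he

lemma mem_quaternionSpan {s : ℂ} (hs : s ≠ 0) {f : BPoly} {d : ℕ} (hf : f.IsHomogeneous d)
    (hA : matAct genA f = f) (hB : matAct genB f = f) : f ∈ quaternionSpan s d := by
  have key : Submodule.span ℂ {g : BPoly | ∃ m n, m + n = d ∧ g = Px ^ m * Py ^ n} ≤
      (quaternionSpan s d).comap quaternionSum := by
    rw [Submodule.span_le]
    rintro _ ⟨m, n, rfl, rfl⟩
    obtain ⟨e, he4, he1, hAe⟩ : ∃ e : ℂ, e ^ 4 = 1 ∧ (e = 1 → (m + 3 * n) % 4 = 0) ∧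
        matAct genA (Px ^ m * Py ^ n) = C e * (Px ^ m * Py ^ n) := by
      refine ⟨Complex.I ^ (m + 3 * n), ?_, fun h => (I_pow_eq_one_iff _).1 h, ?_⟩
      · rw [← pow_mul, I_pow_eq_one_iff]
        omega
      · have hI3 : (C Complex.I : BPoly) ^ 3 = -C Complex.I := by
          linear_combination C Complex.I * C_I_sq
        rw [matAct_mul, matAct_pow, matAct_pow, genA_Px, genA_Py, pow_add, pow_mul, C_mul, C_pow,
          C_pow, C_pow, hI3]
        ring
    have hsum : quaternionSum (Px ^ m * Py ^ n) = (1 + e + e * e + e * (e * e)) •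
        (Px ^ m * Py ^ n + matAct genB (Px ^ m * Py ^ n)) := by
      simp only [quaternionSum, LinearMap.comp_apply, LinearMap.add_apply, Module.End.one_apply,
        actLin_apply, hAe, matAct_mul genA (C _), matAct_C, matAct_add, matAct_mul genB (C _),
        smul_eq_C_mul, C_add, C_mul, C_1]
      ring
    change quaternionSum (Px ^ m * Py ^ n) ∈ quaternionSpan s (m + n)
    rw [hsum]
    by_cases h : e = 1
    · exact Submodule.smul_mem _ _ (quaternionSpan_monomial hs (he1 h))
    · rw [geom_sum_four he4 h, zero_smul]
      exact Submodule.zero_mem _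
  have h8 : quaternionSum f = (8 : ℂ) • f := by
    simp only [quaternionSum, LinearMap.comp_apply, LinearMap.add_apply, Module.End.one_apply,
      actLin_apply, matAct_add, hA, hB]
    module
  have := key (mem_span_monomials_of_isHomogeneous hf)
  rw [Submodule.mem_comap, h8] at this
  exact (Submodule.smul_mem_iff _ (by norm_num)).1 this

/-- Powers of a plane are spanned by monomials in its two generators. -/
lemma span_pair_pow_le (u v : BPoly) (k : ℕ) :
    Submodule.span ℂ {u, v} ^ k ≤
      Submodule.span ℂ {g | ∃ a b, a + b = k ∧ g = u ^ a * v ^ b} := by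
  induction k with
  | zero =>
    rw [pow_zero, Submodule.one_eq_span]
    exact Submodule.span_mono (by rintro _ rfl; exact ⟨0, 0, by simp⟩)
  | succ k ih =>
    rw [pow_succ]
    refine (mul_le_mul_left ih _).trans ?_
    rw [Submodule.span_mul_span]
    refine Submodule.span_mono ?_
    rintro _ ⟨_, ⟨a, b, rfl, rfl⟩, w, (rfl | rfl), rfl⟩
    · exact ⟨a + 1, b, by ring, by ring⟩
    · exact ⟨a, b + 1, by ring, by ring⟩

lemma aeval_homogenize_eq_prod (U V : BPoly) (N : ℕ) (p : Polynomial ℂ) (hp : p ≠ 0)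
    (hN : p.natDegree ≤ N) :
    ∃ c : ℂ, c ≠ 0 ∧ ∃ lam mu : Fin N → ℂ, (∀ i, (lam i, mu i) ≠ (0, 0)) ∧
      aeval ![U, V] (p.homogenize N) = C c * ∏ i, (C (lam i) * U + C (mu i) * V) := by
  induction N generalizing p with
  | zero =>
    obtain ⟨c, rfl⟩ : ∃ c, p = Polynomial.C c :=
      ⟨_, Polynomial.eq_C_of_natDegree_eq_zero (by omega)⟩
    refine ⟨c, fun h => hp (by simp [h]), 0, 0, fun i => i.elim0, ?_⟩
    simp [algebraMap_eq]
  | succ N ih =>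
    obtain ⟨l, m, q, hlm, hq, hqN, e⟩ : ∃ (l m : ℂ) (q : Polynomial ℂ), (l, m) ≠ (0, 0) ∧
        q ≠ 0 ∧ q.natDegree ≤ N ∧ aeval ![U, V] (p.homogenize (N + 1)) =
          (C l * U + C m * V) * aeval ![U, V] (q.homogenize N) := by
      by_cases h : p.natDegree ≤ N
      · refine ⟨0, 1, p, by simp, hp, h, ?_⟩
        have := Polynomial.homogenize_mul 1 p (m := 1) (by simp) h
        rw [one_mul, add_comm] at this
        rw [this]
        simp
      · obtain ⟨a, ha⟩ := Complex.exists_root (f := p)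
          (Polynomial.natDegree_pos_iff_degree_pos.1 (by omega))
        obtain ⟨q, rfl⟩ := Polynomial.dvd_iff_isRoot.2 ha
        have hq : q ≠ 0 := right_ne_zero_of_mul hp
        have hqN : q.natDegree ≤ N := by
          rw [Polynomial.natDegree_mul (Polynomial.X_sub_C_ne_zero a) hq,
            Polynomial.natDegree_X_sub_C] at hN
          omega
        refine ⟨1, -a, q, by simp, hq, hqN, ?_⟩
        have := Polynomial.homogenize_mul (Polynomial.X - Polynomial.C a) q (m := 1) (by simp) hqN
        rw [add_comm] at this
        rw [this]
        simp [algebraMap_eq, sub_eq_add_neg]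
    obtain ⟨c, hc, lam, mu, hne, e'⟩ := ih q hq hqN
    refine ⟨c, hc, Fin.cons l lam, Fin.cons m mu,
      Fin.cases (by simpa using hlm) (by simpa using hne), ?_⟩
    rw [e, e', Fin.prod_univ_succ]
    simp only [Fin.cons_zero, Fin.cons_succ]
    ring

lemma exists_homogenize_of_mem_span (G U V : BPoly) (N : ℕ) {f : BPoly}
    (hf : f ∈ Submodule.span ℂ {g | ∃ i j, i + j = N ∧ g = G * (U ^ i * V ^ j)}) :
    ∃ p : Polynomial ℂ, p.natDegree ≤ N ∧ f = G * aeval ![U, V] (p.homogenize N) := by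
  induction hf using Submodule.span_induction with
  | mem _ h =>
    obtain ⟨i, j, rfl, rfl⟩ := h
    refine ⟨Polynomial.X ^ i, by simp, ?_⟩
    rw [Polynomial.homogenize_X_pow (by omega)]
    simp
  | zero => exact ⟨0, by simp⟩
  | add _ _ _ _ h1 h2 =>
    obtain ⟨p, hp, rfl⟩ := h1
    obtain ⟨q, hq, rfl⟩ := h2
    exact ⟨p + q, Polynomial.natDegree_add_le_of_degree_le hp hq, by simp [mul_add]⟩
  | smul c _ _ h =>
    obtain ⟨p, hp, rfl⟩ := h
    exact ⟨c • p, (Polynomial.natDegree_smul_le c p).trans hp, by simp⟩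

lemma mem_span_isotypic {s : ℂ} (hs : s ^ 2 = -3) {h : BPoly} {k : ℕ} (hk : h ∈ pencil s ^ k)
    {c : ℂ} (hc : c ^ 3 = 1) (hC : matAct genC h = C c * h) :
    h ∈ Submodule.span ℂ {g | ∃ a b, a + b = k ∧ (-(1 + s) / 2) ^ (a + 2 * b) = c ∧
      g = quartic s ^ a * quartic (-s) ^ b} := by
  set w := -(1 + s) / 2 with hw
  have hw2 : -(1 + -s) / 2 = w ^ 2 := by
    rw [hw]
    linear_combination (-1 / 4) * hs
  have hw3 : w ^ 3 = 1 := by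
    rw [hw]
    linear_combination (-1 / 8 * (s + 3)) * hs
  set T := Submodule.span ℂ {g | ∃ a b, a + b = k ∧ w ^ (a + 2 * b) = c ∧
      g = quartic s ^ a * quartic (-s) ^ b}
  have key : Submodule.span ℂ {g | ∃ a b, a + b = k ∧ g = quartic s ^ a * quartic (-s) ^ b} ≤
      T.comap (1 + (c ^ 2) • actLin genC + c • actLin genC ∘ₗ actLin genC) := by
    rw [Submodule.span_le]
    rintro _ ⟨a, b, rfl, rfl⟩
    set g := quartic s ^ a * quartic (-s) ^ b with hg
    have hCg : matAct genC g = C (w ^ (a + 2 * b)) * g := by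
      rw [hg, matAct_mul, matAct_pow, matAct_pow, genC_quartic hs,
        genC_quartic (s := -s) (by rw [neg_sq, hs]), hw2, ← hw, pow_add, pow_mul]
      simp only [C_mul, C_pow]
      ring
    have he3 : (w ^ (a + 2 * b)) ^ 3 = 1 := by rw [← pow_mul, mul_comm, pow_mul, hw3, one_pow]
    change (1 + (c ^ 2) • actLin genC + c • actLin genC ∘ₗ actLin genC) g ∈ T
    by_cases h : w ^ (a + 2 * b) = c
    · simp only [LinearMap.add_apply, LinearMap.smul_apply, LinearMap.comp_apply,
        Module.End.one_apply, actLin_apply, hCg, matAct_mul, matAct_C]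
      simp only [← smul_eq_C_mul]
      have : g ∈ T := Submodule.subset_span ⟨a, b, rfl, h, rfl⟩
      apply_rules [Submodule.add_mem, Submodule.smul_mem]
    · generalize w ^ (a + 2 * b) = e at *
      have h0 : 1 + c ^ 2 * e + c * (e * e) = 0 := by
        apply mul_left_cancel₀ (sub_ne_zero.2 h)
        linear_combination c * he3 - e * hc
      have : (1 + (c ^ 2) • actLin genC + c • actLin genC ∘ₗ actLin genC) g =
          (1 + c ^ 2 * e + c * (e * e)) • g := by
        simp only [LinearMap.add_apply, LinearMap.smul_apply, LinearMap.comp_apply,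
          Module.End.one_apply, actLin_apply, hCg, matAct_mul, matAct_C, smul_eq_C_mul, C_add,
          C_mul, C_1]
        ring
      rw [this, h0, zero_smul]
      exact Submodule.zero_mem _
  have h3 : (1 + (c ^ 2) • actLin genC + c • actLin genC ∘ₗ actLin genC) h = (3 : ℂ) • h := by
    have hc' : (C c : BPoly) ^ 3 = 1 := by rw [← C_pow, hc, C_1]
    simp only [LinearMap.add_apply, LinearMap.smul_apply, LinearMap.comp_apply,
      Module.End.one_apply, actLin_apply, hC, matAct_mul, matAct_C, smul_eq_C_mul, C_pow,
      map_ofNat]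
    linear_combination 2 * h * hc'
  have := key (span_pair_pow_le _ _ k hk)
  rw [Submodule.mem_comap, h3] at this
  exact (Submodule.smul_mem_iff _ (by norm_num)).1 this

lemma exists_factorization {s : ℂ} (hs : s ^ 2 = -3) {h : BPoly} (h0 : h ≠ 0) {k : ℕ}
    (hk : h ∈ pencil s ^ k) {c : ℂ} (hc : c ^ 3 = 1) (hC : matAct genC h = C c * h) :
    ∃ c : ℂ, c ≠ 0 ∧ ∃ (α β N : ℕ) (lam mu : Fin N → ℂ), (∀ i, (lam i, mu i) ≠ (0, 0)) ∧
      h = C c * (quartic s ^ α * quartic (-s) ^ β *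
        ∏ i, (C (lam i) * quartic s ^ 3 + C (mu i) * quartic (-s) ^ 3)) := by
  have hT := mem_span_isotypic hs hk hc hC
  set w := -(1 + s) / 2 with hw
  have hord : orderOf w = 3 := by
    apply orderOf_eq_prime
    · rw [hw]
      linear_combination (-1 / 8 * (s + 3)) * hs
    · intro h
      have : s = -3 := by linear_combination -2 * h + 2 * hw
      rw [this] at hs
      norm_num at hs
  have hfin : IsOfFinOrder w := orderOf_pos_iff.1 (by omega)
  obtain ⟨a₀, b₀, rfl, hab⟩ : ∃ a b, a + b = k ∧ w ^ (a + 2 * b) = c := by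
    by_contra hne
    apply h0
    rw [← Submodule.mem_bot ℂ, ← Submodule.span_empty]
    refine Submodule.span_mono ?_ hT
    rintro _ ⟨a, b, h1, h2, -⟩
    exact hne ⟨a, b, h1, h2⟩
  have hT' : h ∈ Submodule.span ℂ {g | ∃ i j, i + j = a₀ / 3 + b₀ / 3 ∧
      g = quartic s ^ (a₀ % 3) * quartic (-s) ^ (b₀ % 3) *
        ((quartic s ^ 3) ^ i * (quartic (-s) ^ 3) ^ j)} := by
    refine Submodule.span_mono ?_ hT
    rintro _ ⟨a, b, h1, h2, rfl⟩
    rw [← hab, hfin.pow_eq_pow_iff_modEq, hord, Nat.ModEq] at h2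
    refine ⟨a / 3, b / 3, by omega, ?_⟩
    rw [show a₀ % 3 = a % 3 by omega, show b₀ % 3 = b % 3 by omega]
    conv_lhs => rw [← Nat.mod_add_div a 3, ← Nat.mod_add_div b 3]
    rw [pow_add, pow_add, pow_mul, pow_mul]
    ring
  obtain ⟨p, hpN, e⟩ := exists_homogenize_of_mem_span _ _ _ _ hT'
  have hp : p ≠ 0 := by
    rintro rfl
    exact h0 (by simpa using e)
  obtain ⟨c', hc', lam, mu, hne, e'⟩ :=
    aeval_homogenize_eq_prod (quartic s ^ 3) (quartic (-s) ^ 3) _ p hp hpN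
  refine ⟨c', hc', a₀ % 3, b₀ % 3, _, lam, mu, hne, ?_⟩
  rw [e, e']
  ring

lemma SemiInv.of_eq {A : Matrix (Fin 2) (Fin 2) ℂ} {f : BPoly} (h : matAct A f = f) :
    SemiInv A f := ⟨1, one_ne_zero, by rw [h, C_1, one_mul]⟩

/-- Klein's products of ground forms are semi-invariant under any substitution that rescales the
ground forms and fixes the cubes of the quartic ones. -/
lemma SemiInv.ground_product {A : Matrix (Fin 2) (Fin 2) ℂ} {P Q R : BPoly} {p q : ℂ}
    (hp : p ^ 3 = 1) (hq : q ^ 3 = 1) (hP : matAct A P = C p * P) (hQ : matAct A Q = C q * Q)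
    (hR : matAct A R = R) (c : ℂ) (α β γ N : ℕ) (lam mu : Fin N → ℂ) :
    SemiInv A (C c * (P ^ α * Q ^ β * R ^ γ * ∏ i, (C (lam i) * P ^ 3 + C (mu i) * Q ^ 3))) := by
  have hp0 : p ≠ 0 := by rintro rfl; norm_num at hp
  have hq0 : q ≠ 0 := by rintro rfl; norm_num at hq
  refine (SemiInv.const A c).mul ((((SemiInv.pow ⟨p, hp0, hP⟩ α).mul
    (SemiInv.pow ⟨q, hq0, hQ⟩ β)).mul ((SemiInv.of_eq hR).pow γ)).mul
      (SemiInv.prod _ _ fun i _ => SemiInv.of_eq ?_))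
  rw [matAct_add, matAct_mul, matAct_mul, matAct_C, matAct_C, matAct_pow, matAct_pow, hP, hQ,
    mul_pow, mul_pow, ← C_pow, ← C_pow, hp, hq, C_1, one_mul, one_mul]

/-- Klein's classification of semi-invariants of the binary tetrahedral group `T`,
generated by `diag(i,-i)`, `[[0,i],[i,0]]` and `(1/2)[[1+i,-1+i],[1+i,1-i]]`:
a nonzero binary form is semi-invariant under every element of `T` iff it is a
nonzero scalar multiple of `F₁^α F₂^β F₃^γ ∏ᵢ (λᵢ F₁³ + μᵢ F₂³)`, where
`F₁ = x⁴ + 2√-3 x²y² + y⁴`, `F₂ = x⁴ - 2√-3 x²y² + y⁴`, `F₃ = xy(x⁴-y⁴)`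
are the ground forms. -/
theorem semiInv_tetrahedral_iff
    (s3 : ℂ) (hs3 : s3 ^ 2 = -3)
    (M₁ M₂ M₃ : SpecialLinearGroup (Fin 2) ℂ)
    (hM₁ : (M₁ : Matrix (Fin 2) (Fin 2) ℂ) = !![Complex.I, 0; 0, -Complex.I])
    (hM₂ : (M₂ : Matrix (Fin 2) (Fin 2) ℂ) = !![0, Complex.I; Complex.I, 0])
    (hM₃ : (M₃ : Matrix (Fin 2) (Fin 2) ℂ) =
      !![(1 + Complex.I) / 2, (-1 + Complex.I) / 2;
         (1 + Complex.I) / 2, (1 - Complex.I) / 2])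
    (f : BPoly) (hbf : IsBinaryForm f) :
    (∀ A : SpecialLinearGroup (Fin 2) ℂ, A ∈ Subgroup.closure {M₁, M₂, M₃} →
        SemiInv (A : Matrix (Fin 2) (Fin 2) ℂ) f) ↔
      ∃ c : ℂ, c ≠ 0 ∧ ∃ (α β γ N : ℕ) (lam mu : Fin N → ℂ),
        (∀ i, (lam i, mu i) ≠ (0, 0)) ∧
        f = C c * ((Px ^ 4 + C (2 * s3) * Px ^ 2 * Py ^ 2 + Py ^ 4) ^ α *
          (Px ^ 4 - C (2 * s3) * Px ^ 2 * Py ^ 2 + Py ^ 4) ^ β *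
          (Px * Py * (Px ^ 4 - Py ^ 4)) ^ γ *
          ∏ i : Fin N,
            (C (lam i) * (Px ^ 4 + C (2 * s3) * Px ^ 2 * Py ^ 2 + Py ^ 4) ^ 3 +
             C (mu i) * (Px ^ 4 - C (2 * s3) * Px ^ 2 * Py ^ 2 + Py ^ 4) ^ 3)) := by
  rw [← quartic_neg s3]
  change _ ↔ ∃ c : ℂ, c ≠ 0 ∧ ∃ (α β γ N : ℕ) (lam mu : Fin N → ℂ),
    (∀ i, (lam i, mu i) ≠ (0, 0)) ∧ f = C c * (quartic s3 ^ α * quartic (-s3) ^ β * sextic ^ γ *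
      ∏ i : Fin N, (C (lam i) * quartic s3 ^ 3 + C (mu i) * quartic (-s3) ^ 3))
  obtain ⟨hf, d, hd⟩ := hbf
  have hs0 : s3 ≠ 0 := by rintro rfl; norm_num at hs3
  constructor
  · intro H
    obtain ⟨a, -, hA⟩ := H M₁ (Subgroup.subset_closure (by simp))
    obtain ⟨b, hb, hB⟩ := H M₂ (Subgroup.subset_closure (by simp))
    obtain ⟨c, hc, hC⟩ := H M₃ (Subgroup.subset_closure (by simp))
    rw [hM₁] at hA
    rw [hM₂] at hB
    rw [hM₃] at hC
    obtain ⟨rfl, rfl, hc3⟩ := eigenvalues_of_semiInv hf hb hc hA hB hC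
    rw [C_1, one_mul] at hA hB
    have hmem := mem_quaternionSpan hs0 hd hA hB
    rw [quaternionSpan] at hmem
    split_ifs at hmem with h4
    · obtain ⟨c', hc', α, β, N, lam, mu, hne, e⟩ := exists_factorization hs3 hf hmem hc3 hC
      exact ⟨c', hc', α, β, 0, N, lam, mu, hne, by rw [pow_zero, mul_one]; exact e⟩
    · obtain ⟨h, hh, rfl⟩ := hmem
      rw [LinearMap.mulLeft_apply] at hf hC
      have hCh : matAct genC h = C c * h := by
        apply mul_left_cancel₀ (left_ne_zero_of_mul hf)
        change matAct genC (sextic * h) = _ at hC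
        rw [matAct_mul, genC_sextic] at hC
        rw [hC]
        ring
      obtain ⟨c', hc', α, β, N, lam, mu, hne, e⟩ :=
        exists_factorization hs3 (right_ne_zero_of_mul hf) hh hc3 hCh
      refine ⟨c', hc', α, β, 1, N, lam, mu, hne, ?_⟩
      rw [LinearMap.mulLeft_apply, pow_one]
      conv_lhs => rw [e]
      ring
  · rintro ⟨c, -, α, β, γ, N, lam, mu, -, rfl⟩ A hA
    refine SemiInv.of_mem_closure ?_ hA
    rintro B (rfl | rfl | rfl)
    · rw [hM₁]
      exact SemiInv.ground_product (p := 1) (q := 1) (by norm_num) (by norm_num)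
        (by rw [C_1, one_mul]; exact genA_quartic _) (by rw [C_1, one_mul]; exact genA_quartic _)
        genA_sextic ..
    · rw [hM₂]
      exact SemiInv.ground_product (p := 1) (q := 1) (by norm_num) (by norm_num)
        (by rw [C_1, one_mul]; exact genB_quartic _) (by rw [C_1, one_mul]; exact genB_quartic _)
        genB_sextic ..
    · rw [hM₃]
      exact SemiInv.ground_product (by linear_combination (-1 / 8 * (s3 + 3)) * hs3)
        (by linear_combination (-1 / 8 * (-s3 + 3)) * hs3) (genC_quartic hs3)
        (genC_quartic (by rw [neg_sq, hs3])) genC_sextic ..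

end
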